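/- Let α = π/√2 and r ≠ 0, and define the vector field e₀ : ℝ × [0,1] → ℝ² by e₀(x,z) = (−√2 r sin(αx) cos(πz), r cos(αx) sin(πz)). Then: (i) e₀ is divergence-free, 2π/α-periodic in x, its second component vanishes at z = 0 and z = 1, and the z-derivative of its first component vanishes at z = 0 and z = 1; (ii) the zero set of e₀ in ℝ × [0,1] is exactly {((k + 1/2)√2, 1/2) : k ∈ ℤ} ∪ {(k√2, 0) : k ∈ ℤ} ∪ {(k√2, 1) : k ∈ ℤ}; (iii) at each zero ((k + 1/2)√2, 1/2) the Jacobian determinant of e₀ equals r²π², and at each zero (k√2, 0) and (k√2, 1) it equals −r²π²; in particular every zero of e₀ is non-degenerate, i.e. e₀ is a regular divergence-free vector field. -/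

import Mathlib

open Real

/-- ∂/∂x of a real-valued function of (x, z). -/
noncomputable def pdx (f : ℝ → ℝ → ℝ) (x z : ℝ) : ℝ :=
  deriv (fun t => f t z) x

/-- ∂/∂z of a real-valued function of (x, z). -/
noncomputable def pdz (f : ℝ → ℝ → ℝ) (x z : ℝ) : ℝ :=
  deriv (fun t => f x t) z

/-- First component of the roll vector field e₀. -/
noncomputable def e1 (α r : ℝ) (x z : ℝ) : ℝ :=
  -Real.sqrt 2 * r * Real.sin (α * x) * Real.cos (π * z)

/-- Second component of the roll vector field e₀. -/
noncomputable def e2 (α r : ℝ) (x z : ℝ) : ℝ :=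
  r * Real.cos (α * x) * Real.sin (π * z)

/-- Jacobian determinant of e₀. -/
noncomputable def jacDet (α r : ℝ) (x z : ℝ) : ℝ :=
  pdx (e1 α r) x z * pdz (e2 α r) x z - pdz (e1 α r) x z * pdx (e2 α r) x z

theorem pdx_e1 (α r x z : ℝ) :
    pdx (e1 α r) x z = -(Real.sqrt 2 * α) * r * Real.cos (α * x) * Real.cos (π * z) := by
  have h : HasDerivAt (fun t => Real.sin (α * t)) (Real.cos (α * x) * (α * 1)) x :=
    ((hasDerivAt_id x).const_mul α).sin
  have := ((h.const_mul (-Real.sqrt 2 * r)).mul_const (Real.cos (π * z))).deriv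
  simp only [pdx, e1]
  rw [this]
  ring

theorem pdz_e1 (α r x z : ℝ) :
    pdz (e1 α r) x z = Real.sqrt 2 * r * π * Real.sin (α * x) * Real.sin (π * z) := by
  have h : HasDerivAt (fun t => Real.cos (π * t)) (-Real.sin (π * z) * (π * 1)) z :=
    ((hasDerivAt_id z).const_mul π).cos
  have := (h.const_mul (-Real.sqrt 2 * r * Real.sin (α * x))).deriv
  simp only [pdz, e1]
  rw [this]
  ring

theorem pdx_e2 (α r x z : ℝ) :
    pdx (e2 α r) x z = -α * r * Real.sin (α * x) * Real.sin (π * z) := by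
  have h : HasDerivAt (fun t => Real.cos (α * t)) (-Real.sin (α * x) * (α * 1)) x :=
    ((hasDerivAt_id x).const_mul α).cos
  have := ((h.const_mul r).mul_const (Real.sin (π * z))).deriv
  simp only [pdx, e2]
  rw [this]
  ring

theorem pdz_e2 (α r x z : ℝ) :
    pdz (e2 α r) x z = π * r * Real.cos (α * x) * Real.cos (π * z) := by
  have h : HasDerivAt (fun t => Real.sin (π * t)) (Real.cos (π * z) * (π * 1)) z :=
    ((hasDerivAt_id z).const_mul π).sin
  have := (h.const_mul (r * Real.cos (α * x))).deriv
  simp only [pdz, e2]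
  rw [this]
  ring

theorem jacDet_eq {α : ℝ} (hα : Real.sqrt 2 * α = π) (r x z : ℝ) :
    jacDet α r x z = r ^ 2 * π ^ 2 * (Real.sin (α * x) ^ 2 * Real.sin (π * z) ^ 2 -
      Real.cos (α * x) ^ 2 * Real.cos (π * z) ^ 2) := by
  rw [jacDet, pdx_e1, pdx_e2, pdz_e1, pdz_e2, ← hα]
  ring

theorem sin_mul_eq_zero_iff {α : ℝ} (hα : Real.sqrt 2 * α = π) (x : ℝ) :
    Real.sin (α * x) = 0 ↔ ∃ k : ℤ, x = (k : ℝ) * Real.sqrt 2 := by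
  have h0 : α ≠ 0 := by rintro rfl; simp [pi_ne_zero.symm] at hα
  rw [Real.sin_eq_zero_iff]
  refine exists_congr fun k => ⟨fun h => ?_, fun h => ?_⟩
  · rw [← hα] at h
    exact mul_left_cancel₀ h0 (by linear_combination -h)
  · rw [h, ← hα]
    ring

theorem cos_mul_eq_zero_iff {α : ℝ} (hα : Real.sqrt 2 * α = π) (x : ℝ) :
    Real.cos (α * x) = 0 ↔ ∃ k : ℤ, x = ((k : ℝ) + 1 / 2) * Real.sqrt 2 := by
  have h0 : α ≠ 0 := by rintro rfl; simp [pi_ne_zero.symm] at hα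
  rw [Real.cos_eq_zero_iff]
  refine exists_congr fun k => ⟨fun h => ?_, fun h => ?_⟩
  · rw [← hα] at h
    exact mul_left_cancel₀ h0 (by linear_combination h)
  · rw [h, ← hα]
    ring

theorem sin_pi_mul_eq_zero_iff {z : ℝ} (h0 : 0 ≤ z) (h1 : z ≤ 1) :
    Real.sin (π * z) = 0 ↔ z = 0 ∨ z = 1 := by
  constructor
  · intro h
    by_contra! hz
    have h0' : 0 < z := lt_of_le_of_ne h0 hz.1.symm
    have h1' : z < 1 := lt_of_le_of_ne h1 hz.2
    exact (Real.sin_pos_of_pos_of_lt_pi (by positivity) (by nlinarith [pi_pos])).ne' h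
  · rintro (rfl | rfl) <;> simp

theorem cos_pi_mul_eq_zero_iff {z : ℝ} (h0 : 0 ≤ z) (h1 : z ≤ 1) :
    Real.cos (π * z) = 0 ↔ z = 1 / 2 := by
  constructor
  · intro h
    have := Real.injOn_cos
      (show π * z ∈ Set.Icc 0 π from ⟨by positivity, by nlinarith [pi_pos]⟩)
      (show π / 2 ∈ Set.Icc 0 π from ⟨by positivity, by linarith [pi_pos]⟩) (by simp [h])
    exact mul_left_cancel₀ pi_ne_zero (by linear_combination this)
  · rintro rfl
    rw [show π * (1 / 2) = π / 2 by ring, Real.cos_pi_div_two]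

theorem e1_e2_eq_zero_iff {r : ℝ} (hr : r ≠ 0) (α x z : ℝ) :
    (e1 α r x z = 0 ∧ e2 α r x z = 0) ↔
      (Real.cos (α * x) = 0 ∧ Real.cos (π * z) = 0) ∨
        (Real.sin (α * x) = 0 ∧ Real.sin (π * z) = 0) := by
  have hx := Real.sin_sq_add_cos_sq (α * x)
  have hz := Real.sin_sq_add_cos_sq (π * z)
  have h2 : Real.sqrt 2 ≠ 0 := by positivity
  simp only [e1, e2, mul_eq_zero, neg_eq_zero, hr, h2, false_or]
  constructor
  · rintro ⟨h | h, h' | h'⟩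
    · simp [h, h'] at hx
    · exact Or.inr ⟨h, h'⟩
    · exact Or.inl ⟨h', h⟩
    · simp [h, h'] at hz
  · rintro (⟨h, h'⟩ | ⟨h, h'⟩) <;> simp [h, h']

/-- The determinant at a zero of both cosines. -/
theorem jacDet_of_cos_eq_zero {α r x z : ℝ} (hα : Real.sqrt 2 * α = π)
    (hx : Real.cos (α * x) = 0) (hz : Real.cos (π * z) = 0) :
    jacDet α r x z = r ^ 2 * π ^ 2 := by
  rw [jacDet_eq hα, Real.sin_sq, Real.sin_sq, hx, hz]
  ring

/-- The determinant at a zero of both sines. -/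
theorem jacDet_of_sin_eq_zero {α r x z : ℝ} (hα : Real.sqrt 2 * α = π)
    (hx : Real.sin (α * x) = 0) (hz : Real.sin (π * z) = 0) :
    jacDet α r x z = -(r ^ 2 * π ^ 2) := by
  rw [jacDet_eq hα, Real.cos_sq', Real.cos_sq', hx, hz]
  ring

/-- structure of the roll vector field e₀:
divergence-free, periodic, free-free boundary conditions, explicit zero set,
explicit Jacobian determinants at the zeros, and regularity. -/
theorem stmt17 (α r : ℝ) (hα : α = π / Real.sqrt 2) (hr : r ≠ 0) :
    -- (i)
    (∀ x z : ℝ, pdx (e1 α r) x z + pdz (e2 α r) x z = 0) ∧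
    (∀ x z : ℝ, e1 α r (x + 2 * π / α) z = e1 α r x z ∧
                e2 α r (x + 2 * π / α) z = e2 α r x z) ∧
    (∀ x : ℝ, e2 α r x 0 = 0 ∧ e2 α r x 1 = 0) ∧
    (∀ x : ℝ, pdz (e1 α r) x 0 = 0 ∧ pdz (e1 α r) x 1 = 0) ∧
    -- (ii)
    (∀ x z : ℝ, 0 ≤ z → z ≤ 1 →
      ((e1 α r x z = 0 ∧ e2 α r x z = 0) ↔
        ((∃ k : ℤ, x = ((k : ℝ) + 1/2) * Real.sqrt 2 ∧ z = 1/2) ∨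
         (∃ k : ℤ, x = (k : ℝ) * Real.sqrt 2 ∧ (z = 0 ∨ z = 1))))) ∧
    -- (iii)
    (∀ k : ℤ, jacDet α r (((k : ℝ) + 1/2) * Real.sqrt 2) (1/2) = r^2 * π^2 ∧
              jacDet α r ((k : ℝ) * Real.sqrt 2) 0 = -(r^2 * π^2) ∧
              jacDet α r ((k : ℝ) * Real.sqrt 2) 1 = -(r^2 * π^2)) ∧
    (∀ x z : ℝ, 0 ≤ z → z ≤ 1 →
      (e1 α r x z = 0 ∧ e2 α r x z = 0) → jacDet α r x z ≠ 0) := by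
  have hα' : Real.sqrt 2 * α = π := by rw [hα]; field_simp
  have h0 : α ≠ 0 := by rw [hα]; positivity
  have hdet : r ^ 2 * π ^ 2 ≠ 0 := by positivity
  refine ⟨fun x z => ?_, fun x z => ?_, fun x => ?_, fun x => ?_, fun x z hz0 hz1 => ?_,
    fun k => ⟨?_, ?_, ?_⟩, fun x z _ _ h => ?_⟩
  · rw [pdx_e1, pdz_e2, hα']
    ring
  · have h : α * (x + 2 * π / α) = α * x + 2 * π := by field_simp
    simp only [e1, e2, h, Real.sin_add_two_pi, Real.cos_add_two_pi, and_self]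
  · simp [e2]
  · simp [pdz_e1]
  · rw [e1_e2_eq_zero_iff hr, cos_mul_eq_zero_iff hα', sin_mul_eq_zero_iff hα',
      cos_pi_mul_eq_zero_iff hz0 hz1, sin_pi_mul_eq_zero_iff hz0 hz1, exists_and_right,
      exists_and_right]
  · exact jacDet_of_cos_eq_zero hα' ((cos_mul_eq_zero_iff hα' _).2 ⟨k, rfl⟩)
      ((cos_pi_mul_eq_zero_iff (by norm_num) (by norm_num)).2 rfl)
  · exact jacDet_of_sin_eq_zero hα' ((sin_mul_eq_zero_iff hα' _).2 ⟨k, rfl⟩) (by simp)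
  · exact jacDet_of_sin_eq_zero hα' ((sin_mul_eq_zero_iff hα' _).2 ⟨k, rfl⟩) (by simp)
  · rcases (e1_e2_eq_zero_iff hr α x z).1 h with ⟨hx, hz⟩ | ⟨hx, hz⟩
    · rwa [jacDet_of_cos_eq_zero hα' hx hz]
    · rwa [jacDet_of_sin_eq_zero hα' hx hz, neg_ne_zero]
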